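/- Let the (ℓ+1)×(ℓ+1) symmetric tridiagonal matrix H̃(λ,t) have diagonal entries p_j = j(j+1−2t)/ε for j = 0,...,ℓ and off-diagonal entries −λ, with 0 < ε ≤ 1/10 and λ ∈ [0,2]. If t ≤ 0, then the spectral gap of H̃(λ,t) is at least 3/4 and its ground state is O(ε)-close (in Euclidean norm, up to phase) to the standard basis vector e_0; if t ≥ ℓ+1, the same holds with e_ℓ. -/

import Mathlib

/-- The `(ℓ+1) × (ℓ+1)` real symmetric tridiagonal matrix with diagonal entries `p 0, ..., p ℓ`
and all off-diagonal entries equal to `-lam`. -/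
def tridiag (ℓ : ℕ) (p : Fin (ℓ + 1) → ℝ) (lam : ℝ) :
    Matrix (Fin (ℓ + 1)) (Fin (ℓ + 1)) ℝ :=
  Matrix.of fun i j =>
    if i = j then p i
    else if (i : ℕ) + 1 = (j : ℕ) ∨ (j : ℕ) + 1 = (i : ℕ) then -lam
    else 0

/-- The eigenvalues of a Hermitian matrix, sorted in increasing order. -/
noncomputable def sortedEigenvalues {N : ℕ} {𝕜 : Type} [RCLike 𝕜]
    {A : Matrix (Fin N) (Fin N) 𝕜} (hA : A.IsHermitian) : Fin N → ℝ :=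
  hA.eigenvalues ∘ Tuple.sort hA.eigenvalues

/-- The Euclidean norm of a real vector. -/
noncomputable def vecNorm {N : ℕ} (v : Fin N → ℝ) : ℝ :=
  Real.sqrt (∑ j, v j ^ 2)

open Finset

/-- The adjacency matrix of the path on `ℓ + 1` vertices. -/
def pathAdj (ℓ : ℕ) (i j : Fin (ℓ + 1)) : ℝ :=
  if (i : ℕ) + 1 = (j : ℕ) ∨ (j : ℕ) + 1 = (i : ℕ) then 1 else 0

lemma pathAdj_nonneg (ℓ : ℕ) (i j : Fin (ℓ + 1)) : 0 ≤ pathAdj ℓ i j := by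
  unfold pathAdj; split_ifs <;> norm_num

lemma pathAdj_comm (ℓ : ℕ) (i j : Fin (ℓ + 1)) : pathAdj ℓ i j = pathAdj ℓ j i := by
  unfold pathAdj; simp only [or_comm]

lemma sum_pathAdj_le (ℓ : ℕ) (i : Fin (ℓ + 1)) : ∑ j, pathAdj ℓ i j ≤ 2 := by
  simp only [pathAdj, sum_boole]
  rw [filter_or]
  have h₁ : #{j : Fin (ℓ + 1) | (i : ℕ) + 1 = (j : ℕ)} ≤ 1 :=
    card_le_one.2 fun a ha b hb => by
      simp only [mem_filter, mem_univ, true_and] at ha hb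
      exact Fin.ext (by omega)
  have h₂ : #{j : Fin (ℓ + 1) | (j : ℕ) + 1 = (i : ℕ)} ≤ 1 :=
    card_le_one.2 fun a ha b hb => by
      simp only [mem_filter, mem_univ, true_and] at ha hb
      exact Fin.ext (by omega)
  exact_mod_cast (card_union_le _ _).trans (by omega)

lemma sum_sq_pathAdj_mul_le (ℓ : ℕ) (x : Fin (ℓ + 1) → ℝ) :
    ∑ i, (∑ j, pathAdj ℓ i j * x j) ^ 2 ≤ 4 * ∑ j, x j ^ 2 := by
  have hrow : ∀ i, (∑ j, pathAdj ℓ i j * x j) ^ 2 ≤ 2 * ∑ j, pathAdj ℓ i j * x j ^ 2 := by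
    intro i
    have h := sum_sq_le_sum_mul_sum_of_sq_le_mul univ (r := fun j => pathAdj ℓ i j * x j)
      (f := fun j => pathAdj ℓ i j) (g := fun j => pathAdj ℓ i j * x j ^ 2)
      (fun j _ => pathAdj_nonneg ℓ i j)
      (fun j _ => mul_nonneg (pathAdj_nonneg ℓ i j) (sq_nonneg _)) (fun j _ => le_of_eq (by ring))
    exact h.trans (mul_le_mul_of_nonneg_right (sum_pathAdj_le ℓ i)
      (sum_nonneg fun j _ => mul_nonneg (pathAdj_nonneg ℓ i j) (sq_nonneg _)))
  calc ∑ i, (∑ j, pathAdj ℓ i j * x j) ^ 2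
      ≤ ∑ i, 2 * ∑ j, pathAdj ℓ i j * x j ^ 2 := sum_le_sum fun i _ => hrow i
    _ = 2 * ∑ j, (∑ i, pathAdj ℓ j i) * x j ^ 2 := by
        rw [← mul_sum, sum_comm]
        simp only [sum_mul, pathAdj_comm]
    _ ≤ 2 * ∑ j, 2 * x j ^ 2 := by
        gcongr with j
        exact sum_pathAdj_le ℓ j
    _ = 4 * ∑ j, x j ^ 2 := by rw [← mul_sum]; ring

lemma tridiag_mulVec (ℓ : ℕ) (p : Fin (ℓ + 1) → ℝ) (lam : ℝ) (x : Fin (ℓ + 1) → ℝ)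
    (i : Fin (ℓ + 1)) :
    (tridiag ℓ p lam).mulVec x i = p i * x i - lam * ∑ j, pathAdj ℓ i j * x j := by
  have h : ∀ j, tridiag ℓ p lam i j * x j =
      (if i = j then p i * x j else 0) - lam * (pathAdj ℓ i j * x j) := by
    intro j
    unfold tridiag pathAdj
    rw [Matrix.of_apply]
    by_cases hij : i = j
    · subst hij; simp
    · simp only [hij, if_false]; split_ifs <;> ring
  simp only [Matrix.mulVec, dotProduct, h, sum_sub_distrib, ← mul_sum]
  simp

/-- On vectors vanishing at `k`, the quadratic form of a tridiagonal matrix is bounded below by the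
smallest remaining diagonal entry minus twice the off-diagonal size. -/
lemma le_tridiag_quadForm {ℓ : ℕ} {p : Fin (ℓ + 1) → ℝ} {lam m : ℝ} (hlam : 0 ≤ lam)
    {k : Fin (ℓ + 1)} (hp : ∀ j, j ≠ k → m ≤ p j) {x : Fin (ℓ + 1) → ℝ} (hx : x k = 0) :
    (m - 2 * lam) * ∑ i, x i ^ 2 ≤ ∑ i, x i * (tridiag ℓ p lam).mulVec x i := by
  have h : ∀ i, m * x i ^ 2 - lam * (x i ^ 2 + (∑ j, pathAdj ℓ i j * x j) ^ 2 / 4) ≤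
      x i * (tridiag ℓ p lam).mulVec x i := by
    intro i
    rw [tridiag_mulVec]
    have h₁ : m * x i ^ 2 ≤ p i * x i ^ 2 := by
      by_cases hi : i = k
      · simp [hi, hx]
      · exact mul_le_mul_of_nonneg_right (hp i hi) (sq_nonneg _)
    nlinarith [mul_nonneg hlam (sq_nonneg (x i - (∑ j, pathAdj ℓ i j * x j) / 2))]
  have hsum := sum_le_sum fun i (_ : i ∈ univ) => h i
  simp only [sum_sub_distrib, ← mul_sum, sum_add_distrib, ← sum_div] at hsum
  nlinarith [mul_le_mul_of_nonneg_left (sum_sq_pathAdj_mul_le ℓ x) hlam]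

lemma sortedEigenvalues_mono {N : ℕ} {A : Matrix (Fin N) (Fin N) ℝ} (hA : A.IsHermitian) :
    Monotone (sortedEigenvalues hA) :=
  Tuple.monotone_sort _

lemma sortedEigenvalues_zero_le {ℓ : ℕ} {A : Matrix (Fin (ℓ + 1)) (Fin (ℓ + 1)) ℝ}
    (hA : A.IsHermitian) (i : Fin (ℓ + 1)) : sortedEigenvalues hA 0 ≤ hA.eigenvalues i := by
  have h := sortedEigenvalues_mono hA (Fin.zero_le ((Tuple.sort hA.eigenvalues).symm i))
  simpa [sortedEigenvalues] using h

lemma sortedEigenvalues_zero_le_diag {ℓ : ℕ} {A : Matrix (Fin (ℓ + 1)) (Fin (ℓ + 1)) ℝ}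
    (hA : A.IsHermitian) (k : Fin (ℓ + 1)) : sortedEigenvalues hA 0 ≤ A k k := by
  set b := hA.eigenvectorBasis
  have hone : ∑ i, b i k ^ 2 = 1 := by
    have h := b.sum_inner_mul_inner (EuclideanSpace.single k 1) (EuclideanSpace.single k 1)
    simpa [EuclideanSpace.inner_single_left, EuclideanSpace.inner_single_right, sq] using h
  have hdiag : ∑ i, hA.eigenvalues i * b i k ^ 2 = A k k := by
    have h := b.sum_inner_mul_inner (EuclideanSpace.single k 1) (WithLp.toLp 2 (A.col k))
    have h2 : ∀ i, inner ℝ (b i) (WithLp.toLp 2 (A.col k)) = hA.eigenvalues i * b i k := by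
      intro i
      have h3 := congrFun (hA.mulVec_eigenvectorBasis i) k
      have h4 : inner ℝ (b i) (WithLp.toLp 2 (A.col k)) = A.mulVec (b i) k := by
        simp only [PiLp.inner_apply, Matrix.mulVec, dotProduct, Matrix.col_apply]
        refine sum_congr rfl fun j _ => ?_
        have := hA.apply k j
        simp only [star_trivial] at this
        simp [this]
      rw [h4]; simpa using h3
    simp only [h2] at h
    simp only [EuclideanSpace.inner_single_left] at h
    simp only [map_one, one_mul, Matrix.col_apply] at h
    rw [← h]
    exact sum_congr rfl fun i _ => by ring
  calc sortedEigenvalues hA 0 = ∑ i, sortedEigenvalues hA 0 * b i k ^ 2 := by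
        rw [← mul_sum, hone, mul_one]
    _ ≤ ∑ i, hA.eigenvalues i * b i k ^ 2 := sum_le_sum fun i _ =>
        mul_le_mul_of_nonneg_right (sortedEigenvalues_zero_le hA i) (sq_nonneg _)
    _ = A k k := hdiag

/-- Courant–Fischer lower bound for the second eigenvalue, tested on the hyperplane `x k = 0`. -/
lemma le_sortedEigenvalues_one {ℓ : ℕ} (hℓ : 1 ≤ ℓ) {A : Matrix (Fin (ℓ + 1)) (Fin (ℓ + 1)) ℝ}
    (hA : A.IsHermitian) (k : Fin (ℓ + 1)) {c : ℝ}
    (hc : ∀ x : Fin (ℓ + 1) → ℝ, x k = 0 → c * ∑ i, x i ^ 2 ≤ ∑ i, x i * A.mulVec x i) :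
    c ≤ sortedEigenvalues hA 1 := by
  set b := hA.eigenvectorBasis
  obtain ⟨n, rfl⟩ : ∃ n, ℓ = n + 1 := ⟨ℓ - 1, by omega⟩
  set s := Tuple.sort hA.eigenvalues
  have hne : s 0 ≠ s 1 := fun h => by simpa using s.injective h
  have hortho : ∀ i j, ∑ l, b i l * b j l = if i = j then 1 else 0 := by
    intro i j
    have h := orthonormal_iff_ite.1 b.orthonormal i j
    rw [← h, PiLp.inner_apply]
    exact sum_congr rfl fun l _ => by simp [mul_comm]
  have huu : ∑ l, b (s 0) l * b (s 0) l = 1 := by simp [hortho]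
  have hww : ∑ l, b (s 1) l * b (s 1) l = 1 := by simp [hortho]
  have huw : ∑ l, b (s 0) l * b (s 1) l = 0 := by simp [hortho, hne]
  have heig : ∀ i l, A.mulVec (b (s i)) l = sortedEigenvalues hA i * b (s i) l := fun i l => by
    simpa [sortedEigenvalues] using congrFun (hA.mulVec_eigenvectorBasis (s i)) l
  have hle : sortedEigenvalues hA 0 ≤ sortedEigenvalues hA 1 :=
    sortedEigenvalues_mono hA (Fin.zero_le 1)
  have key : ∀ a d : ℝ, a * b (s 0) k + d * b (s 1) k = 0 → 0 < a ^ 2 + d ^ 2 →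
      c ≤ sortedEigenvalues hA 1 := by
    intro a d hk had
    have h := hc (a • (b (s 0)).ofLp + d • (b (s 1)).ofLp) (by simpa using hk)
    have h₁ : ∑ i, (a • (b (s 0)).ofLp + d • (b (s 1)).ofLp) i ^ 2 = a ^ 2 + d ^ 2 := by
      calc _ = a ^ 2 * ∑ l, b (s 0) l * b (s 0) l + d ^ 2 * ∑ l, b (s 1) l * b (s 1) l
            + 2 * a * d * ∑ l, b (s 0) l * b (s 1) l := by
            simp only [mul_sum, ← sum_add_distrib, Pi.add_apply, Pi.smul_apply, smul_eq_mul]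
            exact sum_congr rfl fun l _ => by ring
        _ = _ := by rw [huu, hww, huw]; ring
    have h₂ : ∑ i, (a • (b (s 0)).ofLp + d • (b (s 1)).ofLp) i *
        A.mulVec (a • (b (s 0)).ofLp + d • (b (s 1)).ofLp) i =
        sortedEigenvalues hA 0 * a ^ 2 + sortedEigenvalues hA 1 * d ^ 2 := by
      calc _ = sortedEigenvalues hA 0 * a ^ 2 * ∑ l, b (s 0) l * b (s 0) l
            + sortedEigenvalues hA 1 * d ^ 2 * ∑ l, b (s 1) l * b (s 1) l
            + (sortedEigenvalues hA 0 + sortedEigenvalues hA 1) * a * d *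
              ∑ l, b (s 0) l * b (s 1) l := by
            simp only [mul_sum, ← sum_add_distrib, Matrix.mulVec_add, Matrix.mulVec_smul,
              Pi.add_apply, Pi.smul_apply, smul_eq_mul, heig]
            exact sum_congr rfl fun l _ => by ring
        _ = _ := by rw [huu, hww, huw]; ring
    rw [h₁, h₂] at h
    refine le_of_mul_le_mul_right (h.trans ?_) had
    nlinarith [mul_le_mul_of_nonneg_right hle (sq_nonneg a)]
  by_cases h0 : b (s 1) k = 0
  · exact key 0 1 (by simp [h0]) (by norm_num)
  · exact key (b (s 1) k) (-b (s 0) k) (by ring) (by positivity)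

/-- A tridiagonal matrix with one diagonal entry well below the others is gapped, and its ground
state is close to the corresponding basis vector. -/
lemma tridiag_gap_and_groundState {ℓ : ℕ} (hℓ : 1 ≤ ℓ) {ε lam : ℝ} (hε : 0 < ε)
    (hε' : ε ≤ 1 / 10) (hlam : 0 ≤ lam) (hlam' : lam ≤ 2) {p : Fin (ℓ + 1) → ℝ}
    (k : Fin (ℓ + 1)) (hp : ∀ j, j ≠ k → p k + 2 / ε ≤ p j)
    (hA : (tridiag ℓ p lam).IsHermitian) :
    sortedEigenvalues hA 1 - sortedEigenvalues hA 0 ≥ 3 / 4 ∧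
      ∀ v : Fin (ℓ + 1) → ℝ, vecNorm v = 1 →
        (tridiag ℓ p lam).mulVec v = sortedEigenvalues hA 0 • v →
        ∃ α : ℝ, |α| = 1 ∧
          vecNorm (fun j => α * (if j = k then 1 else 0) - v j) ≤ 3 * ε := by
  have hdiag : sortedEigenvalues hA 0 ≤ p k := by
    simpa [tridiag] using sortedEigenvalues_zero_le_diag hA k
  refine ⟨?_, fun v hv hev => ?_⟩
  · have h := le_sortedEigenvalues_one hℓ hA k fun x hx => le_tridiag_quadForm hlam hp hx
    have h20 : 20 ≤ 2 / ε := by rw [le_div_iff₀ hε]; linarith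
    linarith
  · have hv1 : ∑ j, v j ^ 2 = 1 := by simpa [vecNorm] using hv
    have hsplit : v k ^ 2 + ∑ j ∈ univ.erase k, v j ^ 2 = 1 := by
      rw [add_sum_erase _ (fun j => v j ^ 2) (mem_univ k), hv1]
    set S := ∑ j ∈ univ.erase k, v j ^ 2 with hS
    have hS0 : 0 ≤ S := sum_nonneg fun j _ => sq_nonneg _
    have hpt : ∀ j, j ≠ k → v j ^ 2 ≤ ε ^ 2 * (∑ i, pathAdj ℓ j i * v i) ^ 2 := by
      intro j hj
      have h := congrFun hev j
      rw [tridiag_mulVec, Pi.smul_apply, smul_eq_mul] at h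
      set y := ∑ i, pathAdj ℓ j i * v i
      have hd : 2 / ε ≤ p j - sortedEigenvalues hA 0 := by linarith [hp j hj]
      have h2 : 2 ≤ (p j - sortedEigenvalues hA 0) * ε := (div_le_iff₀ hε).1 hd
      have h3 : (p j - sortedEigenvalues hA 0) * ε * v j = ε * lam * y := by
        linear_combination ε * h
      have h4 : (2 * v j) ^ 2 ≤ (ε * 2 * y) ^ 2 := by
        calc (2 * v j) ^ 2 ≤ ((p j - sortedEigenvalues hA 0) * ε * v j) ^ 2 := by
              rw [mul_pow, mul_pow _ (v j)]; gcongr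
          _ = (ε * lam * y) ^ 2 := by rw [h3]
          _ ≤ (ε * 2 * y) ^ 2 := by
              rw [mul_pow _ y, mul_pow _ y]; gcongr
      nlinarith
    have hSε : S ≤ 4 * ε ^ 2 := by
      calc S ≤ ∑ j ∈ univ.erase k, ε ^ 2 * (∑ i, pathAdj ℓ j i * v i) ^ 2 :=
            sum_le_sum fun j hj => hpt j (ne_of_mem_erase hj)
        _ ≤ ∑ j, ε ^ 2 * (∑ i, pathAdj ℓ j i * v i) ^ 2 :=
            sum_le_sum_of_subset_of_nonneg (erase_subset _ _) fun j _ _ => by positivity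
        _ ≤ ε ^ 2 * (4 * 1) := by
            rw [← mul_sum, ← hv1]; gcongr; exact sum_sq_pathAdj_mul_le ℓ v
        _ = 4 * ε ^ 2 := by ring
    obtain ⟨α, hα, hαv⟩ : ∃ α : ℝ, |α| = 1 ∧ α * v k = |v k| := by
      rcases le_total 0 (v k) with h | h
      · exact ⟨1, by simp, by rw [abs_of_nonneg h, one_mul]⟩
      · exact ⟨-1, by simp, by rw [abs_of_nonpos h]; ring⟩
    refine ⟨α, hα, ?_⟩
    have hα2 : α ^ 2 = 1 := by rw [← sq_abs, hα, one_pow]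
    have hsum : ∑ j, (α * (if j = k then 1 else 0) - v j) ^ 2 = (α - v k) ^ 2 + S := by
      rw [← add_sum_erase _ _ (mem_univ k), hS]
      congr 1
      · simp
      · exact sum_congr rfl fun j hj => by simp [ne_of_mem_erase hj]
    have habs : |v k| ^ 2 = v k ^ 2 := sq_abs _
    unfold vecNorm
    rw [Real.sqrt_le_left (by positivity), hsum]
    have h1 : |v k| ≤ 1 := by nlinarith [abs_nonneg (v k)]
    nlinarith [abs_nonneg (v k)]

/-- for the tridiagonal matrix `H̃(λ,t)` with diagonal `p_j = j(j+1−2t)/ε` and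
off-diagonals `−λ` (`0 < ε ≤ 1/10`, `λ ∈ [0,2]`): if `t ≤ 0` its spectral gap is at least
`3/4` and every unit ground state is `O(ε)`-close (up to phase) to `e_0`; if `t ≥ ℓ+1` the
same holds with `e_ℓ`. -/
theorem toy_shift_endpoints :
    ∃ C : ℝ, 0 < C ∧ ∀ (ℓ : ℕ) (ε lam t : ℝ), 1 ≤ ℓ → 0 < ε → ε ≤ 1 / 10 →
      0 ≤ lam → lam ≤ 2 →
      ∀ hA : (tridiag ℓ (fun j => (j : ℝ) * ((j : ℝ) + 1 - 2 * t) / ε) lam).IsHermitian,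
      (t ≤ 0 →
        sortedEigenvalues hA 1 - sortedEigenvalues hA 0 ≥ 3 / 4 ∧
        ∀ v : Fin (ℓ + 1) → ℝ, vecNorm v = 1 →
          (tridiag ℓ (fun j => (j : ℝ) * ((j : ℝ) + 1 - 2 * t) / ε) lam).mulVec v =
            sortedEigenvalues hA 0 • v →
          ∃ α : ℝ, |α| = 1 ∧
            vecNorm (fun j => α * (if j = (0 : Fin (ℓ + 1)) then 1 else 0) - v j) ≤ C * ε) ∧
      (t ≥ (ℓ : ℝ) + 1 →
        sortedEigenvalues hA 1 - sortedEigenvalues hA 0 ≥ 3 / 4 ∧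
        ∀ v : Fin (ℓ + 1) → ℝ, vecNorm v = 1 →
          (tridiag ℓ (fun j => (j : ℝ) * ((j : ℝ) + 1 - 2 * t) / ε) lam).mulVec v =
            sortedEigenvalues hA 0 • v →
          ∃ α : ℝ, |α| = 1 ∧
            vecNorm (fun j => α * (if j = Fin.last ℓ then 1 else 0) - v j) ≤ C * ε) := by
  refine ⟨3, by norm_num, fun ℓ ε lam t hℓ hε hε' hlam hlam' hA => ⟨fun ht => ?_, fun ht => ?_⟩⟩
  · refine tridiag_gap_and_groundState hℓ hε hε' hlam hlam' 0 (fun j hj => ?_) hA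
    have hj1 : (1 : ℝ) ≤ (j : ℕ) := by
      exact_mod_cast Nat.one_le_iff_ne_zero.2 (Fin.val_ne_zero_iff.2 hj)
    rw [Fin.val_zero, Nat.cast_zero, zero_mul, zero_div, zero_add]
    gcongr
    nlinarith
  · refine tridiag_gap_and_groundState hℓ hε hε' hlam hlam' (Fin.last ℓ) (fun j hj => ?_) hA
    have hj1 : ((j : ℕ) : ℝ) + 1 ≤ ℓ := by
      exact_mod_cast Fin.val_lt_last hj
    rw [Fin.val_last, ← add_div]
    gcongr
    nlinarith [mul_le_mul_of_nonneg_left ht (by linarith : (0 : ℝ) ≤ ℓ - (j : ℕ))]
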